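/- For every g ≥ 1, setting H̃_g(X) := X²·H_g(X) as a formal power series over ℚ, the following identity of formal power series holds: (1−X)²·H̃_g'(X) + (1−X)·H̃_g(X) = X⁴·H̃_{g−1}'''(X) + 2·X³·H̃_{g−1}''(X), where ' denotes the formal derivative of power series. -/

import Mathlib

/-- The permutation of `ZMod (n+1)` fixing `0` and acting as `π` on `{1,…,n}`
(the element `i+1` of `ZMod (n+1)` corresponding to `i : Fin n`). -/
def pihat {n : ℕ} (π : Equiv.Perm (Fin n)) : Equiv.Perm (ZMod (n+1)) :=
  Equiv.Perm.decomposeFin.symm (0, π)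

/-- The permutation `v ↦ π̂ (π̂⁻¹ (v+1) - 1)` of `ZMod (n+1)`, whose orbits are the
alternating cycles of the cycle graph of `π`. -/
def cpi {n : ℕ} (π : Equiv.Perm (Fin n)) : Equiv.Perm (ZMod (n+1)) :=
  (Equiv.addRight (1 : ZMod (n+1))).trans
    ((pihat π).symm.trans ((Equiv.subRight (1 : ZMod (n+1))).trans (pihat π)))

/-- `A n π` is the number of alternating cycles of the cycle graph of `π`: the number of
orbits of the cyclic group generated by `cpi π` acting on `ZMod (n+1)`. -/
noncomputable def A (n : ℕ) (π : Equiv.Perm (Fin n)) : ℕ :=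
  Nat.card (MulAction.orbitRel.Quotient (Subgroup.zpowers (cpi π)) (ZMod (n+1)))

/-- The Hultman number `H n k`: the number of permutations of `Fin n` whose cycle graph
has exactly `k` alternating cycles. -/
noncomputable def H (n k : ℕ) : ℕ := Nat.card {π : Equiv.Perm (Fin n) // A n π = k}

/-- The genus-`g` generating function `H_g(X) = Σ_{n≥0} H(n, n+1-2g) Xⁿ` of the Hultman
numbers, as a formal power series over `ℚ`. -/
noncomputable def HgQ (g : ℕ) : PowerSeries ℚ :=
  PowerSeries.mk fun n => (H n (n + 1 - 2 * g) : ℚ)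

/-- `H̃_g(X) = X² H_g(X)`. -/
noncomputable def Ht (g : ℕ) : PowerSeries ℚ := PowerSeries.X ^ 2 * HgQ g


open Equiv Equiv.Perm

/-- number of cycles (with fixed points) -/
noncomputable def cyc {α : Type*} (f : Perm α) : ℕ := Nat.card (Quotient (SameCycle.setoid f))

theorem sameCycle_inv_fun {α β : Type*} {f : Perm α} {ψ : α → β} (h : ∀ a, ψ (f a) = ψ a)
    {a b : α} (hab : SameCycle f a b) : ψ a = ψ b := by
  obtain ⟨i, rfl⟩ := hab
  induction i using Int.induction_on with
  | zero => simp
  | succ n ih => rw [add_comm, zpow_add, zpow_one, mul_apply, h]; exact ih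
  | pred n ih =>
    rw [ih, ← h ((f ^ (-(n:ℤ) - 1)) a), ← mul_apply, ← zpow_one_add]; simp

theorem cyc_congr {α β : Type*} {f : Perm α} {g : Perm β} (e : α ≃ β)
    (h : ∀ a, e (f a) = g (e a)) : cyc f = cyc g := by
  refine Nat.card_congr (Quotient.congr e ?_)
  intro a b
  have hg : g = e.permCongr f := by
    ext b; simp [permCongr_apply, h]
  have hz : ∀ i : ℤ, ∀ a, (g ^ i) (e a) = e ((f ^ i) a) := by
    intro i a
    have : g ^ i = e.permCongr (f ^ i) := by
      rw [hg]; exact (map_zpow e.permCongrHom f i).symm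
    rw [this]; simp [permCongr_apply]
  change SameCycle f a b ↔ SameCycle g (e a) (e b)
  simp [SameCycle, hz]

theorem cyc_conj {α : Type*} (f g : Perm α) : cyc (g * f * g⁻¹) = cyc f :=
  (cyc_congr g (by simp)).symm

theorem cyc_mul_comm {α : Type*} (f g : Perm α) : cyc (g * f) = cyc (f * g) := by
  rw [← cyc_conj (f * g) g]; congr 1; group

theorem cyc_sumCongr {α β : Type*} [Finite α] [Finite β] (u : Perm α) (v : Perm β) :
    cyc (Perm.sumCongr u v) = cyc u + cyc v := by
  unfold cyc
  rw [← Nat.card_sum]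
  refine Nat.card_congr ?_
  have hl : ∀ a b, SameCycle u a b → SameCycle (Perm.sumCongr u v) (Sum.inl a) (Sum.inl b) := by
    intro a b h
    have := sameCycle_inv_fun (f := u)
      (ψ := fun a => (Quotient.mk (SameCycle.setoid (Perm.sumCongr u v)) (Sum.inl a)))
      (fun a => Quotient.sound (by
        change SameCycle _ _ _
        have : (Sum.inl (u a) : α ⊕ β) = Perm.sumCongr u v (Sum.inl a) := by simp
        rw [this, sameCycle_apply_left])) h
    exact Quotient.exact this
  have hr : ∀ a b, SameCycle v a b → SameCycle (Perm.sumCongr u v) (Sum.inr a) (Sum.inr b) := by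
    intro a b h
    have := sameCycle_inv_fun (f := v)
      (ψ := fun a => (Quotient.mk (SameCycle.setoid (Perm.sumCongr u v)) (Sum.inr a)))
      (fun a => Quotient.sound (by
        change SameCycle _ _ _
        have : (Sum.inr (v a) : α ⊕ β) = Perm.sumCongr u v (Sum.inr a) := by simp
        rw [this, sameCycle_apply_left])) h
    exact Quotient.exact this
  refine
    { toFun := Quotient.lift (fun a : α ⊕ β => (Sum.map (Quotient.mk (SameCycle.setoid u))
        (Quotient.mk (SameCycle.setoid v)) a)) ?_
      invFun := Sum.elim (Quotient.lift (fun a => Quotient.mk _ (Sum.inl a)) ?_)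
        (Quotient.lift (fun a => Quotient.mk _ (Sum.inr a)) ?_)
      left_inv := ?_
      right_inv := ?_ }
  · intro a b h
    refine sameCycle_inv_fun (f := Perm.sumCongr u v) ?_ h
    rintro (a | a)
    · simp only [Perm.sumCongr_apply, Sum.map_inl, Sum.inl.injEq]
      exact Quotient.sound (by change SameCycle _ _ _; rw [sameCycle_apply_left])
    · simp only [Perm.sumCongr_apply, Sum.map_inr, Sum.inr.injEq]
      exact Quotient.sound (by change SameCycle _ _ _; rw [sameCycle_apply_left])
  · intro a b h; exact Quotient.sound (hl a b h)
  · intro a b h; exact Quotient.sound (hr a b h)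
  · intro q
    induction q using Quotient.inductionOn with | _ a => rcases a with a | a <;> rfl
  · rintro (q | q) <;> induction q using Quotient.inductionOn <;> rfl

theorem cyc_subtypeCongr {α : Type*} [Finite α] (p : α → Prop) [DecidablePred p]
    (u : Perm {a // p a}) (v : Perm {a // ¬ p a}) :
    cyc (Perm.subtypeCongr u v) = cyc u + cyc v := by
  rw [← cyc_sumCongr]
  refine (cyc_congr (Equiv.sumCompl p) ?_).symm
  intro a; simp [Perm.subtypeCongr, permCongr_apply]

theorem cyc_optionCongr {α : Type*} [Finite α] (u : Perm α) :
    cyc (Equiv.optionCongr u : Perm (Option α)) = cyc u + 1 := by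
  have h1 : cyc (1 : Perm PUnit.{1}) = 1 := by
    unfold cyc
    rw [Nat.card_eq_one_iff_unique]
    exact ⟨⟨fun a b => by
      induction a using Quotient.inductionOn; induction b using Quotient.inductionOn; rfl⟩,
      ⟨Quotient.mk _ PUnit.unit⟩⟩
  rw [← h1, ← cyc_sumCongr]
  refine cyc_congr (Equiv.optionEquivSumPUnit α) ?_
  rintro (_ | a) <;> simp

theorem cyc_mul_swap {α : Type*} [Finite α] [DecidableEq α] (ρ : Perm α) (p q : α)
    (h : ¬ SameCycle ρ p q) : cyc (ρ * swap p q) + 1 = cyc ρ := by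
  have hpq : p ≠ q := by rintro rfl; exact h (SameCycle.refl _ _)
  set ρ' := ρ * swap p q with hρ'
  have h'p : ρ' p = ρ q := by simp [hρ']
  have h'q : ρ' q = ρ p := by simp [hρ']
  have h'o : ∀ a, a ≠ p → a ≠ q → ρ' a = ρ a := by
    intro a h1 h2; simp [hρ', swap_apply_of_ne_of_ne h1 h2]
  have key : SameCycle ρ' p q := by
    by_contra hc
    have hk : ∀ k : ℕ, SameCycle ρ' p ((ρ ^ (k + 1)) q) := by
      intro k
      induction k with
      | zero => simp only [zero_add, pow_one]; rw [← h'p, sameCycle_apply_right]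
      | succ k ih =>
        rw [pow_succ' ρ (k+1), mul_apply, ← h'o, sameCycle_apply_right]
        · exact ih
        · intro h0; apply h; exact (SameCycle.symm ⟨(k+1 : ℕ), by rw [zpow_natCast]; exact h0⟩)
        · intro h0; rw [h0] at ih; exact hc ih
    have := hk (orderOf ρ - 1)
    rw [Nat.sub_add_cancel (orderOf_pos ρ), pow_orderOf_eq_one] at this
    exact hc this
  have hsub : ∀ a b, SameCycle ρ a b → SameCycle ρ' a b := by
    intro a b hab
    refine Quotient.exact (sameCycle_inv_fun (f := ρ)
      (ψ := fun a => (Quotient.mk (SameCycle.setoid ρ') a)) ?_ hab)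
    intro a
    refine Quotient.sound ?_
    change SameCycle ρ' _ _
    by_cases h1 : a = p
    · subst h1; rw [← h'q, sameCycle_apply_left]; exact key.symm
    by_cases h2 : a = q
    · subst h2; rw [← h'p, sameCycle_apply_left]; exact key
    rw [← h'o a h1 h2, sameCycle_apply_left]
  classical
  let φ : α → Quotient (SameCycle.setoid ρ) := fun a =>
    if SameCycle ρ q a then Quotient.mk _ p else Quotient.mk _ a
  have hφ : ∀ a, φ (ρ' a) = φ a := by
    intro a
    have hm : ∀ a, Quotient.mk (SameCycle.setoid ρ) (ρ a) = Quotient.mk _ a := fun a =>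
      Quotient.sound (by change SameCycle _ _ _; rw [sameCycle_apply_left])
    have h0 : ¬ SameCycle ρ q p := fun h0 => h h0.symm
    by_cases h1 : a = p
    · subst h1; simp [φ, h'p, SameCycle.refl]
    by_cases h2 : a = q
    · subst h2; simp [φ, h'q, h0, hm, SameCycle.refl]
    simp [φ, h'o a h1 h2, hm]
  let Φ : Quotient (SameCycle.setoid ρ') → Quotient (SameCycle.setoid ρ) :=
    Quotient.lift φ (fun a b hab => sameCycle_inv_fun hφ hab)
  have hinj : Function.Injective Φ := by
    intro a b
    induction a using Quotient.inductionOn with | _ a => ?_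
    induction b using Quotient.inductionOn with | _ b => ?_
    intro hab
    refine Quotient.sound ?_
    change SameCycle ρ' a b
    change φ a = φ b at hab
    have hm : ∀ a, ∃ c, φ a = Quotient.mk _ c ∧ SameCycle ρ' a c := by
      intro a
      by_cases h1 : SameCycle ρ q a
      · exact ⟨p, by simp [φ, h1], ((hsub _ _ h1).symm).trans key.symm⟩
      · exact ⟨a, by simp [φ, h1], SameCycle.refl _ _⟩
    obtain ⟨c, hc, hc'⟩ := hm a
    obtain ⟨d, hd, hd'⟩ := hm b
    rw [hc, hd] at hab
    exact hc'.trans ((hsub _ _ (Quotient.exact hab)).trans hd'.symm)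
  have hran : Set.range Φ = {Quotient.mk _ q}ᶜ := by
    ext c
    induction c using Quotient.inductionOn with | _ c => ?_
    constructor
    · rintro ⟨a, ha⟩ hc
      rw [hc] at ha
      induction a using Quotient.inductionOn with | _ a => ?_
      change φ a = _ at ha
      by_cases h1 : SameCycle ρ q a
      · simp only [φ, h1, if_true] at ha; exact h (Quotient.exact ha)
      · simp only [φ, h1, if_false] at ha; exact h1 (SameCycle.symm (Quotient.exact ha))
    · intro hc
      refine ⟨Quotient.mk _ c, ?_⟩
      change φ c = _
      have : ¬ SameCycle ρ q c := fun h1 => hc (Quotient.sound (SameCycle.symm h1))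
      simp [φ, this]
  unfold cyc
  have h1 : Nat.card (Quotient (SameCycle.setoid ρ')) = (Set.range Φ).ncard := by
    rw [← Set.image_univ, Set.ncard_image_of_injective _ hinj, Set.ncard_univ]
  rw [h1, hran, ← Set.ncard_univ]
  have := Set.ncard_add_ncard_compl ({Quotient.mk (SameCycle.setoid ρ) q} : Set _)
  rw [Set.ncard_singleton] at this
  rw [Set.ncard_univ]; omega

theorem sum_cyc {R : Type*} [CommRing R] (φ : ℤˣ →* R) (x : R) :
    ∀ (β : Type) [Fintype β] [DecidableEq β],
    ∑ u : Perm β, φ (sign u) * x ^ cyc u =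
      ∏ i ∈ Finset.range (Fintype.card β), (x + φ (-1) * i) := by
  intro β _ _
  refine Finite.induction_empty_option (P := fun β => ∀ (inst : Fintype β) (dec : DecidableEq β),
    ∑ u : Perm β, φ (sign u) * x ^ cyc u =
      ∏ i ∈ Finset.range (Fintype.card β), (x + φ (-1) * i)) ?_ ?_ ?_ β _ _
  · intro α β e ih inst dec
    classical
    let : Fintype α := Fintype.ofEquiv β e.symm
    have := ih this inferInstance
    rw [← Fintype.card_congr e, ← this]
    refine (Fintype.sum_equiv e.permCongr _ _ ?_).symm
    intro u
    rw [sign_permCongr, cyc_congr (f := u) (g := e.permCongr u) e]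
    simp [permCongr_apply]
  · intro inst dec
    have h0 : cyc (1 : Perm PEmpty.{1}) = 0 := by
      unfold cyc
      have : IsEmpty (Quotient (SameCycle.setoid (1 : Perm PEmpty.{1}))) :=
        ⟨fun a => by induction a using Quotient.inductionOn with | _ a => exact a.elim⟩
      simp
    have : (Finset.univ : Finset (Perm PEmpty.{1})) = {1} := by
      ext a; simp
    rw [this]; simp [h0]
  · intro α _ ih inst dec
    classical
    have hd : dec = Option.instDecidableEq := Subsingleton.elim _ _
    subst hd
    have hi : inst = instFintypeOption := Subsingleton.elim _ _
    subst hi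
    rw [← (Perm.decomposeOption).symm.sum_comp, Fintype.sum_prod_type, Fintype.sum_option,
      Fintype.card_option, Finset.prod_range_succ, ← ih inferInstance inferInstance]
    have h1 : ∀ u : Perm α, cyc (Perm.decomposeOption.symm (none, u)) = cyc u + 1 := by
      intro u; rw [← cyc_optionCongr]; simp [← Perm.one_def]
    have h2 : ∀ (b : α) (u : Perm α), cyc (Perm.decomposeOption.symm (some b, u)) = cyc u := by
      intro b u
      rw [Perm.decomposeOption_symm_apply, cyc_mul_comm]
      have := cyc_mul_swap (Equiv.optionCongr u : Perm (Option α)) none (some b) ?_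
      · rw [cyc_optionCongr] at this; exact Nat.succ_injective this
      · intro h
        have := h.eq_of_left (by simp [Function.IsFixedPt])
        simp at this
    have h3 : ∀ (b : α) (u : Perm α), sign (Perm.decomposeOption.symm (some b, u)) = -1 * sign u := by
      intro b u
      rw [Perm.decomposeOption_symm_apply, Perm.sign_mul, sign_swap (by simp), Equiv.optionCongr_sign]
    have h4 : ∀ (u : Perm α), sign (Perm.decomposeOption.symm (none, u)) = sign u := by
      intro u; simp
    simp only [h1, h2, h3, h4, map_mul]
    rw [Finset.sum_const, mul_add]
    congr 1
    · rw [Finset.sum_mul]; exact Finset.sum_congr rfl fun u _ => by ring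
    · rw [Finset.card_univ, nsmul_eq_mul, Finset.sum_mul, Finset.mul_sum]
      exact Finset.sum_congr rfl fun u _ => by ring

noncomputable def eS {α : Type} [Fintype α] [DecidableEq α] (S : Finset α) (σ : Perm α) : ℤ :=
  if h : ∀ a, σ a ∈ S ↔ a ∈ S then (-1) ^ S.card * (sign (σ.subtypePerm h) : ℤ) else 0

theorem eS_of_inv {α : Type} [Fintype α] [DecidableEq α] (S : Finset α) (σ τ : Perm α)
    (h : ∀ a, σ a ∈ S ↔ a ∈ S) (hτ : ∀ a, τ a = if a ∈ S then σ a else a) :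
    eS S σ = (-1) ^ S.card * (sign τ : ℤ) := by
  rw [eS, dif_pos h]
  have : τ = ofSubtype (σ.subtypePerm h) := by
    ext a
    rw [hτ]
    split_ifs with ha
    · rw [ofSubtype_apply_of_mem _ ha]; rfl
    · rw [ofSubtype_apply_of_not_mem _ ha]
  rw [this, sign_ofSubtype]

theorem sign_cycleOf_card {α : Type} [Fintype α] [DecidableEq α] (σ : Perm α) (x : α)
    (O : Finset α) (hO : ∀ y, y ∈ O ↔ SameCycle σ x y) :
    (-1 : ℤ) ^ O.card * (sign (σ.cycleOf x) : ℤ) = -1 := by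
  by_cases hx : σ x = x
  · have h1 : σ.cycleOf x = 1 := (cycleOf_eq_one_iff σ).2 hx
    have h2 : O = {x} := by
      ext y; rw [hO, Finset.mem_singleton]
      constructor
      · intro h; exact (h.eq_of_left hx).symm
      · rintro rfl; exact SameCycle.refl _ _
    simp [h1, h2]
  · have h1 : O = (σ.cycleOf x).support := by
      ext y; rw [hO, mem_support_cycleOf_iff' hx]
    rw [(isCycle_cycleOf σ hx).sign, h1]
    push_cast
    rw [mul_neg, ← mul_pow]; simp

theorem eS_union {α : Type} [Fintype α] [DecidableEq α] (S O : Finset α) (σ : Perm α) (x : α)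
    (hO : ∀ y, y ∈ O ↔ SameCycle σ x y) (hd : Disjoint S O) :
    eS (S ∪ O) σ = - eS S σ := by
  have hOi : ∀ a, σ a ∈ O ↔ a ∈ O := by intro a; rw [hO, hO, sameCycle_apply_right]
  have hdd : ∀ a, a ∈ S → a ∉ O := fun a h1 h2 => Finset.disjoint_left.1 hd h1 h2
  by_cases h : ∀ a, σ a ∈ S ↔ a ∈ S
  · have h' : ∀ a, σ a ∈ S ∪ O ↔ a ∈ S ∪ O := by
      intro a; rw [Finset.mem_union, Finset.mem_union, h, hOi]
    have hτ : ∀ a, (ofSubtype (σ.subtypePerm h)) a = if a ∈ S then σ a else a := by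
      intro a
      split_ifs with ha
      · rw [ofSubtype_apply_of_mem _ ha]; rfl
      · rw [ofSubtype_apply_of_not_mem _ ha]
    rw [eS_of_inv S σ (ofSubtype (σ.subtypePerm h)) h hτ,
      eS_of_inv (S ∪ O) σ (ofSubtype (σ.subtypePerm h) * σ.cycleOf x) h', Perm.sign_mul,
      Finset.card_union_of_disjoint hd, pow_add]
    · have := sign_cycleOf_card σ x O hO
      push_cast
      linear_combination ((-1) ^ S.card * (sign (ofSubtype (σ.subtypePerm h)) : ℤ)) * this
    · intro a
      rw [Perm.mul_apply, cycleOf_apply, hτ]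
      by_cases haO : a ∈ O
      · have h1 := (hO a).1 haO
        have h2 : σ a ∉ S := fun h2 => hdd _ h2 ((hOi a).2 haO)
        simp [h1, haO, h2]
      · have h1 : ¬ SameCycle σ x a := fun h1 => haO ((hO a).2 h1)
        simp [h1, haO]
  · have h' : ¬ ∀ a, σ a ∈ S ∪ O ↔ a ∈ S ∪ O := by
      intro h'
      apply h
      intro a
      have h1 := h' a
      rw [Finset.mem_union, Finset.mem_union] at h1
      have h2 := hOi a
      have h3 := hdd a
      have h4 := hdd (σ a)
      tauto
    simp only [eS]
    rw [dif_neg h', dif_neg h, neg_zero]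

theorem sum_eS {α : Type} [Fintype α] [DecidableEq α] (σ : Perm α) (z : α) :
    ∑ S ∈ (Finset.univ : Finset (Finset α)).filter (fun S => z ∉ S), eS S σ =
      if ∀ y, SameCycle σ z y then 1 else 0 := by
  classical
  split_ifs with ht
  · rw [Finset.sum_eq_single_of_mem ∅ (by simp)]
    · rw [eS_of_inv ∅ σ 1] <;> simp
    · intro S hS hne
      rw [Finset.mem_filter] at hS
      rw [eS, dif_neg]
      intro h
      obtain ⟨y, hy⟩ := Finset.nonempty_iff_ne_empty.2 hne
      have := sameCycle_inv_fun (f := σ) (ψ := fun a => a ∈ S) (fun a => propext (h a)) (ht y)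
      exact hS.2 (by simpa [this] using hy)
  · push Not at ht
    obtain ⟨x, hx⟩ := ht
    let O := Finset.univ.filter (fun y => SameCycle σ x y)
    have hO : ∀ y, y ∈ O ↔ SameCycle σ x y := by intro y; simp [O]
    have hz : z ∉ O := by rw [hO]; exact fun h => hx h.symm
    have hxO : x ∈ O := (hO x).2 (SameCycle.refl _ _)
    have hOi : ∀ a, σ a ∈ O ↔ a ∈ O := by intro a; rw [hO, hO, sameCycle_apply_right]
    refine Finset.sum_involution (fun S _ => symmDiff S O) ?_ ?_ ?_ ?_
    · intro S hS
      by_cases h : ∀ a, σ a ∈ S ↔ a ∈ S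
      · have hc := fun y (hy : y ∈ O) => sameCycle_inv_fun (f := σ) (ψ := fun a => a ∈ S)
          (fun a => propext (h a)) ((hO y).1 hy)
        by_cases hxS : x ∈ S
        · have hsub : O ⊆ S := fun y hy => by have := hc y hy; simp only [hxS, eq_iff_iff, true_iff] at this; exact this
          have e1 : symmDiff S O = S \ O := by
            rw [symmDiff_def, Finset.sdiff_eq_empty_iff_subset.2 hsub]; simp
          have e2 : S = (S \ O) ∪ O := by rw [Finset.sdiff_union_of_subset hsub]
          have := eS_union (S \ O) O σ x hO Finset.sdiff_disjoint
          rw [← e2] at this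
          rw [this, e1]; ring
        · have hd : Disjoint S O := by
            rw [Finset.disjoint_right]
            intro y hy; have := hc y hy; simp only [hxS, eq_iff_iff, false_iff] at this; exact this
          have e1 : symmDiff S O = S ∪ O := by
            rw [hd.symmDiff_eq_sup]; rfl
          rw [e1, eS_union S O σ x hO hd]; ring
      · have h' : ¬ ∀ a, σ a ∈ symmDiff S O ↔ a ∈ symmDiff S O := by
          intro h'
          apply h
          intro a
          have h1 := h' a
          rw [Finset.mem_symmDiff, Finset.mem_symmDiff] at h1
          have h2 := hOi a
          tauto
        simp only [eS]
        rw [dif_neg h, dif_neg h']; simp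
    · intro S hS _ h
      have : O = ∅ := by simpa using h
      rw [this] at hxO; simp at hxO
    · intro S hS
      rw [Finset.mem_filter] at hS ⊢
      refine ⟨Finset.mem_univ _, ?_⟩
      rw [Finset.mem_symmDiff]; tauto
    · intro S hS; simp

theorem sum_pairs {α : Type} [Fintype α] [DecidableEq α] {R : Type*} [CommRing R]
    (S : Finset α) (g : Perm α → R) :
    ∑ w : Perm {a // a ∈ S} × Perm {a // ¬ a ∈ S},
      ((sign w.1 : ℤ) : R) * g (Perm.subtypeCongr w.1 w.2) =
    (-1) ^ S.card * ∑ σ : Perm α, ((eS S σ : ℤ) : R) * g σ := by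
  classical
  rw [← Finset.sum_filter_add_sum_filter_not Finset.univ (fun σ : Perm α => ∀ a, σ a ∈ S ↔ a ∈ S)]
  rw [Finset.sum_eq_zero (s := Finset.univ.filter (fun σ : Perm α => ¬ ∀ a, σ a ∈ S ↔ a ∈ S)),
    add_zero, Finset.mul_sum]
  · have hinv : ∀ (w : Perm {a // a ∈ S} × Perm {a // ¬ a ∈ S}) (a : α),
        (Perm.subtypeCongr w.1 w.2) a ∈ S ↔ a ∈ S := by
      intro w a
      by_cases ha : a ∈ S
      · rw [Perm.subtypeCongr.left_apply _ _ ha]; simp [ha]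
      · rw [Perm.subtypeCongr.right_apply _ _ ha]
        simp only [ha, iff_false]; exact (w.2 ⟨a, ha⟩).2
    have hs : ∀ (w : Perm {a // a ∈ S} × Perm {a // ¬ a ∈ S}),
        (Perm.subtypeCongr w.1 w.2).subtypePerm (hinv w) = w.1 := by
      intro w; ext ⟨a, ha⟩; simp [Perm.subtypePerm_apply, Perm.subtypeCongr.left_apply _ _ ha]
    refine Finset.sum_bij' (fun w _ => Perm.subtypeCongr w.1 w.2)
      (fun σ hσ => (σ.subtypePerm (Finset.mem_filter.1 hσ).2,
        σ.subtypePerm (fun a => not_congr ((Finset.mem_filter.1 hσ).2 a)))) ?_ ?_ ?_ ?_ ?_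
    · intro w _; rw [Finset.mem_filter]; exact ⟨Finset.mem_univ _, hinv w⟩
    · intro σ _; exact Finset.mem_univ _
    · intro w _
      refine Prod.ext (hs w) ?_
      ext ⟨a, ha⟩; simp [Perm.subtypePerm_apply, Perm.subtypeCongr.right_apply _ _ ha]
    · intro σ hσ
      ext a
      by_cases ha : a ∈ S
      · rw [Perm.subtypeCongr.left_apply _ _ ha]; rfl
      · rw [Perm.subtypeCongr.right_apply _ _ ha]; rfl
    · intro w _
      rw [eS, dif_pos (hinv w), hs]
      push_cast
      rw [← mul_assoc, ← mul_assoc, ← mul_pow]; simp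
  · intro σ hσ
    rw [Finset.mem_filter] at hσ
    rw [eS, dif_neg hσ.2]; simp

noncomputable def VS {α : Type} [Fintype α] [DecidableEq α] {R : Type*} [CommRing R] (x : R)
    (s : Perm α) (S : Finset α) : R := ∑ σ : Perm α, ((eS S σ : ℤ) : R) * x ^ cyc (σ * s)

theorem VS_eq {α : Type} [Fintype α] [DecidableEq α] {R : Type*} [CommRing R] (x : R)
    (s : Perm α) (S : Finset α) : VS x s S = (-1) ^ S.card *
     ∑ w : Perm {a // a ∈ S} × Perm {a // ¬ a ∈ S},
      ((sign w.1 : ℤ) : R) * x ^ cyc (Perm.subtypeCongr w.1 w.2 * s) := by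
  rw [sum_pairs S (fun σ => x ^ cyc (σ * s)), ← mul_assoc, ← mul_pow]
  simp [VS]

theorem sc_mul {α : Type} [DecidableEq α] (S : Finset α) (u u' : Perm {a // a ∈ S})
    (v v' : Perm {a // ¬ a ∈ S}) :
    Perm.subtypeCongr (u * u') (v * v') = Perm.subtypeCongr u v * Perm.subtypeCongr u' v' :=
  (Perm.subtypeCongr.trans u' u v' v).symm

theorem VS_zero {α : Type} [Fintype α] [DecidableEq α] {R : Type*} [CommRing R] (x : R)
    (s : Perm α) (S : Finset α) (p q : α) (hpq : p ≠ q) (hp : p ∉ S) (hq : q ∉ S)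
    (hp' : s p ∈ S) (hq' : s q ∈ S) : VS x s S = 0 := by
  rw [VS_eq]
  refine mul_eq_zero_of_right _ ?_
  have hne : (⟨s p, hp'⟩ : {a // a ∈ S}) ≠ ⟨s q, hq'⟩ := by
    intro h; exact hpq (s.injective (Subtype.ext_iff.1 h))
  have e1 : Perm.subtypeCongr (swap (⟨s p, hp'⟩ : {a // a ∈ S}) ⟨s q, hq'⟩)
      (1 : Perm {a // ¬ a ∈ S}) = swap (s p) (s q) := by
    ext a
    by_cases ha : a ∈ S
    · rw [Perm.subtypeCongr.left_apply _ _ ha]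
      simp only [swap_apply_def, Subtype.mk.injEq]
      split_ifs <;> rfl
    · rw [Perm.subtypeCongr.right_apply _ _ ha, swap_apply_of_ne_of_ne]
      · rfl
      · rintro rfl; exact ha hp'
      · rintro rfl; exact ha hq'
  have e2 : Perm.subtypeCongr (1 : Perm {a // a ∈ S})
      (swap (⟨p, hp⟩ : {a // ¬ a ∈ S}) ⟨q, hq⟩) = swap p q := by
    ext a
    by_cases ha : a ∈ S
    · rw [Perm.subtypeCongr.left_apply _ _ ha, swap_apply_of_ne_of_ne]
      · rfl
      · rintro rfl; exact hp ha
      · rintro rfl; exact hq ha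
    · rw [Perm.subtypeCongr.right_apply _ _ ha]
      simp only [swap_apply_def, Subtype.mk.injEq]
      split_ifs <;> rfl
  refine Finset.sum_involution (fun w _ => (w.1 * swap ⟨s p, hp'⟩ ⟨s q, hq'⟩,
    swap ⟨p, hp⟩ ⟨q, hq⟩ * w.2)) ?_ ?_ ?_ ?_
  · rintro ⟨u, v⟩ _
    simp only
    have : Perm.subtypeCongr (u * swap ⟨s p, hp'⟩ ⟨s q, hq'⟩) (swap ⟨p, hp⟩ ⟨q, hq⟩ * v) * s
        = swap p q * (Perm.subtypeCongr u v * s) * (swap p q)⁻¹ := by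
      have h1 : Perm.subtypeCongr (u * swap ⟨s p, hp'⟩ ⟨s q, hq'⟩) (swap ⟨p, hp⟩ ⟨q, hq⟩ * v)
        = swap p q * Perm.subtypeCongr u v * swap (s p) (s q) := by
        rw [← e1, ← e2, ← sc_mul, ← sc_mul]; simp
      have h2 : swap (s p) (s q) = s * swap p q * s⁻¹ := by
        rw [mul_swap_eq_swap_mul]; simp
      rw [h1, h2]; simp [mul_assoc]
    rw [this, cyc_conj, Perm.sign_mul, sign_swap hne]
    push_cast; ring
  · rintro ⟨u, v⟩ _ _ h
    have h1 := (Prod.ext_iff.1 h).1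
    have h2 : swap (⟨s p, hp'⟩ : {a // a ∈ S}) ⟨s q, hq'⟩ = 1 := by simpa using h1
    exact hne (swap_eq_one_iff.1 h2)
  · intros; exact Finset.mem_univ _
  · rintro ⟨u, v⟩ _
    simp [mul_assoc]

noncomputable def Rz {R : Type*} [CommRing R] (x : R) (N : ℕ) : R :=
  ∏ i ∈ Finset.range N, (x + i)
noncomputable def Fz {R : Type*} [CommRing R] (x : R) (N : ℕ) : R :=
  ∏ i ∈ Finset.range N, (x - i)

theorem sum_Rz {R : Type*} [CommRing R] (x : R) (β : Type) [Fintype β] [DecidableEq β] :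
    ∑ u : Perm β, x ^ cyc u = Rz x (Fintype.card β) := by
  have := sum_cyc (1 : ℤˣ →* R) x β
  simpa [Rz] using this

theorem sum_Fz {R : Type*} [CommRing R] (x : R) (β : Type) [Fintype β] [DecidableEq β] :
    ∑ u : Perm β, ((sign u : ℤ) : R) * x ^ cyc u = Fz x (Fintype.card β) := by
  have := sum_cyc (((Int.castRingHom R : ℤ →* R)).comp (Units.coeHom ℤ)) x β
  simpa [Fz, sub_eq_add_neg] using this

theorem VS_empty {α : Type} [Fintype α] [DecidableEq α] {R : Type*} [CommRing R] (x : R)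
    (s : Perm α) : VS x s ∅ = Rz x (Fintype.card α) := by
  rw [← sum_Rz, VS]
  refine Fintype.sum_equiv (Equiv.mulRight s) _ _ fun σ => ?_
  rw [eS_of_inv ∅ σ 1] <;> simp

theorem VS_single {α : Type} [Fintype α] [DecidableEq α] {R : Type*} [CommRing R] (x : R)
    (r : Perm α) (S : Finset α) (p q x0 : α) (hp : p ∈ S) (hq : q ∉ S)
    (hS : ∀ y, y ∈ S ↔ SameCycle r x0 y) :
    x * VS x (r * swap p q) S = - (Fz x S.card * Rz x (Fintype.card α - S.card)) := by
  have hi : ∀ a, r a ∈ S ↔ a ∈ S := by intro a; rw [hS, hS, sameCycle_apply_right]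
  have he : eS S r = -1 := by
    have := eS_union ∅ S r x0 hS (by simp)
    rw [Finset.empty_union] at this
    rw [this, eS_of_inv ∅ r 1] <;> simp
  rw [eS, dif_pos hi] at he
  set u0 := r.subtypePerm hi with hu0
  set v0 : Perm {a // ¬ a ∈ S} := r.subtypePerm (fun a => not_congr (hi a)) with hv0
  have hr : r = Perm.subtypeCongr u0 v0 := by
    ext a
    by_cases ha : a ∈ S
    · rw [Perm.subtypeCongr.left_apply _ _ ha]; rfl
    · rw [Perm.subtypeCongr.right_apply _ _ ha]; rfl
  have hinv : ∀ (w : Perm {a // a ∈ S} × Perm {a // ¬ a ∈ S}) (a : α),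
        (Perm.subtypeCongr w.1 w.2) a ∈ S ↔ a ∈ S := by
      intro w a
      by_cases ha : a ∈ S
      · rw [Perm.subtypeCongr.left_apply _ _ ha]; simp [ha]
      · rw [Perm.subtypeCongr.right_apply _ _ ha]
        simp only [ha, iff_false]; exact (w.2 ⟨a, ha⟩).2
  have key : x * ∑ w : Perm {a // a ∈ S} × Perm {a // ¬ a ∈ S},
      ((sign w.1 : ℤ) : R) * x ^ cyc (Perm.subtypeCongr w.1 w.2 * (r * swap p q)) =
      ((sign u0 : ℤ) : R) * (Fz x S.card * Rz x (Fintype.card α - S.card)) := by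
    have c1 : Fintype.card {a // a ∈ S} = S.card := by simp
    have c2 : Fintype.card {a // ¬ a ∈ S} = Fintype.card α - S.card := by
      rw [Fintype.card_subtype_compl, c1]
    rw [← c2, ← c1, ← sum_Rz, ← sum_Fz, Finset.sum_mul_sum, ← Fintype.sum_prod_type',
      Finset.mul_sum, Finset.mul_sum]
    refine Fintype.sum_equiv (Equiv.mulRight (u0, v0)) _ _ ?_
    rintro ⟨u, v⟩
    have hc := cyc_mul_swap (Perm.subtypeCongr (u * u0) (v * v0)) p q (by
      intro h
      have := sameCycle_inv_fun (ψ := fun a => a ∈ S) (fun a => propext (hinv (u * u0, v * v0) a)) h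
      simp only [hp, hq, eq_iff_iff, true_iff] at this)
    rw [cyc_subtypeCongr] at hc
    have h1 : Perm.subtypeCongr u v * (r * swap p q) =
      Perm.subtypeCongr (u * u0) (v * v0) * swap p q := by
      rw [sc_mul, ← hr, mul_assoc]
    have hsq : ((sign u0 : ℤ) : R) * ((sign u0 : ℤ) : R) = 1 := by
      rw [← Int.cast_mul, ← Units.val_mul, ← sq, Int.units_sq]; simp
    simp only [Equiv.coe_mulRight, Prod.mk_mul_mk, h1, Perm.sign_mul]
    push_cast
    calc _ = ((sign u : ℤ) : R) * x ^ (cyc (Perm.subtypeCongr (u * u0) (v * v0) * swap p q) + 1) := by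
            ring
      _ = (((sign u0 : ℤ) : R) * ((sign u0 : ℤ) : R)) * (((sign u : ℤ) : R) *
          (x ^ (cyc (u * u0)) * x ^ cyc (v * v0))) := by rw [hc, hsq, pow_add]; ring
      _ = _ := by ring
  rw [VS_eq, mul_left_comm, key, ← mul_assoc]
  have he' : ((-1) ^ S.card * ((sign u0 : ℤ) : R)) = -1 := by
    have := congrArg (Int.cast : ℤ → R) he
    push_cast at this; exact this
  rw [he']; ring

def TT (n : ℕ) (k i : ℕ) : Finset (Fin (n+1)) :=
  Finset.univ.filter (fun j => i < j.val ∧ j.val ≤ i + k + 1)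

theorem TT_card (n k i : ℕ) (hk : i + k + 1 ≤ n) : (TT n k i).card = k + 1 := by
  have : (TT n k i).map Fin.valEmbedding = Finset.Ioc i (i + k + 1) := by
    ext a
    simp only [TT, Finset.mem_map, Finset.mem_filter, Finset.mem_univ, true_and, Fin.valEmbedding_apply,
      Finset.mem_Ioc]
    constructor
    · rintro ⟨j, hj, rfl⟩; exact hj
    · intro h; exact ⟨⟨a, by omega⟩, h, rfl⟩
  rw [← Finset.card_map Fin.valEmbedding, this, Nat.card_Ioc]; omega

theorem VS_TT {R : Type*} [CommRing R] (x : R) (n k i : ℕ) (hk : i + k + 1 ≤ n)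
    (s : Perm (Fin (n+1))) (hs : ∀ j : Fin (n+1), j.val < n → (s j).val = j.val + 1) :
    x * VS x s (TT n k i) = - (Fz x (k + 1) * Rz x (n - k)) := by
  have hm : ∀ j : Fin (n+1), j ∈ TT n k i ↔ i < j.val ∧ j.val ≤ i + k + 1 := by
    intro j; simp [TT]
  let p : Fin (n+1) := ⟨i + k + 1, by omega⟩
  let q : Fin (n+1) := ⟨i, by omega⟩
  let x0 : Fin (n+1) := ⟨i + 1, by omega⟩
  have hpS : p ∈ TT n k i := by rw [hm]; simp only [p]; omega
  have hqS : q ∉ TT n k i := by rw [hm]; simp only [q]; omega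
  have hpq : p ≠ q := by rintro h; rw [h] at hpS; exact hqS hpS
  set r := s * swap p q with hr
  have hsq : s q = x0 := by
    apply Fin.ext; rw [hs]; simp only [q]; omega
  have hrp : r p = x0 := by simp [hr, hsq]
  have hro : ∀ j, j ≠ p → j ≠ q → r j = s j := by
    intro j h1 h2; simp [hr, swap_apply_of_ne_of_ne h1 h2]
  have hfw : ∀ j, j ∈ TT n k i → r j ∈ TT n k i := by
    intro j hj
    by_cases h1 : j = p
    · rw [h1, hrp, hm]; simp only [x0]; omega
    · have h2 : j ≠ q := by rintro rfl; exact hqS hj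
      rw [hro j h1 h2, hm]
      rw [hm] at hj
      have : j.val ≠ i + k + 1 := fun h => h1 (Fin.ext h)
      rw [hs j (by omega)]; omega
  have hS : ∀ y, y ∈ TT n k i ↔ SameCycle r x0 y := by
    intro y
    constructor
    · intro hy
      rw [hm] at hy
      have : ∀ t (ht : t ≤ k), SameCycle r x0 ⟨i + 1 + t, by omega⟩ := by
        intro t
        induction t with
        | zero => intro _; exact SameCycle.refl _ _
        | succ t ih =>
          intro ht
          have h1 := ih (by omega)
          have h2 : r ⟨i + 1 + t, by omega⟩ = ⟨i + 1 + (t + 1), by omega⟩ := by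
            rw [hro]
            · apply Fin.ext; rw [hs]
              · simp only; omega
              · simp only; omega
            · intro h; have := congrArg Fin.val h; simp only [p] at this; omega
            · intro h; have := congrArg Fin.val h; simp only [q] at this; omega
          rw [← h2, sameCycle_apply_right]; exact h1
      have h3 := this (y.val - (i + 1)) (by omega)
      convert h3 using 1
      apply Fin.ext; simp only; omega
    · intro h
      obtain ⟨m, hm'⟩ := h.exists_nat_pow_eq
      have : ∀ m : ℕ, (r ^ m) x0 ∈ TT n k i := by
        intro m
        induction m with
        | zero => simp only [pow_zero, Perm.one_apply]; rw [hm]; simp only [x0]; omega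
        | succ m ih => rw [pow_succ', Perm.mul_apply]; exact hfw _ ih
      rw [← hm']; exact this m
  have := VS_single x r (TT n k i) p q x0 hpS hqS hS
  rw [hr, mul_assoc, swap_mul_self, mul_one, TT_card n k i hk, Fintype.card_fin] at this
  rw [this]; congr 3; omega

theorem not_TT {n : ℕ} (S : Finset (Fin (n+1))) (h0 : 0 ∉ S) (hne : S ≠ ∅)
    (hT : ∀ k i, i + k + 1 ≤ n → S ≠ TT n k i)
    (s : Perm (Fin (n+1))) (hs : ∀ j : Fin (n+1), j.val < n → (s j).val = j.val + 1) :
    ∃ p q, p ≠ q ∧ p ∉ S ∧ q ∉ S ∧ s p ∈ S ∧ s q ∈ S := by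
  have hn := Finset.nonempty_iff_ne_empty.2 hne
  set m := S.min' hn with hmdef
  set M := S.max' hn with hMdef
  have hmS : m ∈ S := S.min'_mem hn
  have hMS : M ∈ S := S.max'_mem hn
  have hmM : m ≤ M := S.min'_le _ hMS
  have hm0 : m.val ≠ 0 := by intro h; apply h0; have : m = 0 := Fin.ext h
                             rwa [← this]
  have hmMv : m.val ≤ M.val := hmM
  have hMn := M.isLt
  have hgap : ∃ g : Fin (n+1), g ∉ S ∧ m < g ∧ g < M := by
    by_contra hc
    push Not at hc
    apply hT (M.val - m.val) (m.val - 1) (by omega)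
    ext j
    simp only [TT, Finset.mem_filter, Finset.mem_univ, true_and]
    constructor
    · intro hj
      have h1 : m.val ≤ j.val := S.min'_le _ hj
      have h2 : j.val ≤ M.val := S.le_max' _ hj
      omega
    · intro hj
      by_contra hjS
      have h1 : j ≠ m := by rintro rfl; exact hjS hmS
      have h2 : j ≠ M := by rintro rfl; exact hjS hMS
      have h1' : j.val ≠ m.val := fun h => h1 (Fin.ext h)
      have h2' : j.val ≠ M.val := fun h => h2 (Fin.ext h)
      have h3 : m < j := by rw [Fin.lt_def]; omega
      have h4 := hc j hjS h3
      rw [Fin.le_def] at h4; omega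
  obtain ⟨g, hgS, hmg, hgM⟩ := hgap
  have hn2 : (S.filter (fun j => g < j)).Nonempty := ⟨M, by simp [hMS, hgM]⟩
  set c := (S.filter (fun j => g < j)).min' hn2 with hcdef
  have hc := (S.filter (fun j => g < j)).min'_mem hn2
  rw [← hcdef, Finset.mem_filter] at hc
  have hcn := c.isLt
  have hgc : g.val < c.val := hc.2
  have hmg' : m.val < g.val := hmg
  refine ⟨⟨m.val - 1, by omega⟩, ⟨c.val - 1, by omega⟩, ?_, ?_, ?_, ?_, ?_⟩
  · intro h; have := congrArg Fin.val h; simp only at this; omega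
  · intro h; have h1 := S.min'_le _ h
    rw [← hmdef, Fin.le_def] at h1; simp only at h1; omega
  · intro h
    by_cases hcg : c.val - 1 = g.val
    · apply hgS; convert h using 1; exact Fin.ext hcg.symm
    · have h1 := (S.filter (fun j => g < j)).min'_le _ (Finset.mem_filter.2 ⟨h, by
        rw [Fin.lt_def]; simp only; omega⟩)
      rw [← hcdef, Fin.le_def] at h1; simp only at h1; omega
  · convert hmS using 1
    apply Fin.ext; rw [hs]
    · simp only; omega
    · simp only; omega
  · convert hc.1 using 1
    apply Fin.ext; rw [hs]
    · simp only; omega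
    · simp only; omega

theorem sum_VS {R : Type*} [CommRing R] (x : R) (n : ℕ)
    (s : Perm (Fin (n+1))) (hs : ∀ j : Fin (n+1), j.val < n → (s j).val = j.val + 1) :
    x * ∑ S ∈ (Finset.univ : Finset (Finset (Fin (n+1)))).filter (fun S => 0 ∉ S), VS x s S =
      x * Rz x (n + 1) - ∑ k ∈ Finset.range n, ((n - k : ℕ) : R) * (Fz x (k + 1) * Rz x (n - k)) := by
  classical
  let I := (Finset.range n).sigma (fun k => Finset.range (n - k))
  have hI : ∀ a : (Σ _ : ℕ, ℕ), a ∈ I → a.2 + a.1 + 1 ≤ n := by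
    rintro ⟨k, i⟩ h; simp [I] at h; simp only; omega
  have hsub : ∑ S ∈ (Finset.univ : Finset (Finset (Fin (n+1)))).filter (fun S => 0 ∉ S), VS x s S =
      ∑ S ∈ insert ∅ (I.image (fun a => TT n a.1 a.2)), VS x s S := by
    symm
    refine Finset.sum_subset ?_ ?_
    · intro S hS
      rw [Finset.mem_insert, Finset.mem_image] at hS
      rw [Finset.mem_filter]
      refine ⟨Finset.mem_univ _, ?_⟩
      rcases hS with rfl | ⟨a, _, rfl⟩
      · simp
      · simp [TT]
    · intro S hS hn
      rw [Finset.mem_filter] at hS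
      rw [Finset.mem_insert, Finset.mem_image, not_or] at hn
      obtain ⟨p, q, hpq, hp, hq, hp', hq'⟩ := not_TT S hS.2 hn.1 (by
        rintro k i hki rfl
        exact hn.2 ⟨⟨k, i⟩, by simp [I]; omega, rfl⟩) s hs
      exact VS_zero x s S p q hpq hp hq hp' hq'
  rw [hsub, Finset.sum_insert, VS_empty, Fintype.card_fin, mul_add, sub_eq_add_neg,
    Finset.sum_image]
  · congr 1
    rw [Finset.mul_sum, Finset.sum_sigma, ← Finset.sum_neg_distrib]
    refine Finset.sum_congr rfl fun k hk => ?_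
    rw [Finset.sum_congr rfl (g := fun _ => - (Fz x (k + 1) * Rz x (n - k)))]
    · rw [Finset.sum_const, Finset.card_range, nsmul_eq_mul]; ring
    · intro i hi
      rw [Finset.mem_range] at hk hi
      exact VS_TT x n k i (by omega) s hs
  · rintro ⟨k, i⟩ h ⟨k', i'⟩ h' he
    have h1 := hI _ h
    have h2 := hI _ h'
    simp only at h1 h2 he
    have e0 := congrArg Finset.card he
    rw [TT_card n k i h1, TT_card n k' i' h2] at e0
    have hk : k = k' := by omega
    subst hk
    have m1 : (⟨i + 1, by omega⟩ : Fin (n+1)) ∈ TT n k i := by simp [TT]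
    have m2 : (⟨i' + 1, by omega⟩ : Fin (n+1)) ∈ TT n k i' := by simp [TT]
    rw [he] at m1
    rw [← he] at m2
    simp [TT] at m1 m2
    have : i = i' := by omega
    rw [this]
  · rw [Finset.mem_image]
    rintro ⟨a, ha, h⟩
    have := TT_card n a.1 a.2 (hI a ha)
    rw [h] at this; simp at this

theorem sum_trans {R : Type*} [CommRing R] (x : R) (n : ℕ)
    (s : Perm (Fin (n+1))) (hs : ∀ j : Fin (n+1), j.val < n → (s j).val = j.val + 1)
    [DecidablePred fun σ : Perm (Fin (n+1)) => ∀ y, SameCycle σ 0 y] :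
    x * ∑ σ ∈ (Finset.univ : Finset (Perm (Fin (n+1)))).filter (fun σ => ∀ y, SameCycle σ 0 y),
        x ^ cyc (σ * s) =
      x * Rz x (n + 1) - ∑ k ∈ Finset.range n, ((n - k : ℕ) : R) * (Fz x (k + 1) * Rz x (n - k)) := by
  rw [← sum_VS x n s hs]
  congr 1
  simp only [VS]
  rw [Finset.sum_comm, Finset.sum_filter]
  refine Finset.sum_congr rfl fun σ _ => ?_
  rw [← Finset.sum_mul, ← Int.cast_sum, sum_eS]
  split_ifs <;> simp

theorem A_eq_cyc (n : ℕ) (π : Perm (Fin n)) : A n π = cyc (cpi π) := by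
  unfold A cyc
  refine Nat.card_congr (Quotient.congr (Equiv.refl _) ?_)
  intro a b
  change (MulAction.orbitRel _ _) a b ↔ SameCycle (cpi π) a b
  rw [MulAction.orbitRel_apply, sameCycle_comm]
  constructor
  · rintro ⟨⟨g, i, rfl⟩, h⟩
    exact ⟨i, h⟩
  · rintro ⟨i, h⟩
    exact ⟨⟨_, i, rfl⟩, h⟩

def sN (n : ℕ) : Perm (Fin (n+1)) := Equiv.addRight (1 : Fin (n+1))

theorem sN_val (n : ℕ) (j : Fin (n+1)) (h : j.val < n) : (sN n j).val = j.val + 1 := by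
  change (j + 1 : Fin (n+1)).val = _
  exact Fin.val_add_one_of_lt (by rw [Fin.lt_def]; simpa using h)

theorem sN_last (n : ℕ) (j : Fin (n+1)) (h : j.val = n) : sN n j = 0 := by
  have : j = Fin.last n := Fin.ext h
  rw [this]; exact Fin.last_add_one n

theorem sN_pow (n : ℕ) (j : Fin (n+1)) : ((sN n) ^ j.val) 0 = j := by
  have : ∀ t (ht : t < n + 1), ((sN n) ^ t) 0 = ⟨t, ht⟩ := by
    intro t
    induction t with
    | zero => intro _; rfl
    | succ t ih =>
      intro ht
      rw [pow_succ', Perm.mul_apply, ih (by omega)]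
      apply Fin.ext; rw [sN_val]; simp only; omega
  exact this j.val j.isLt

def pih {n : ℕ} (π : Perm (Fin n)) : Perm (Fin (n+1)) := Perm.decomposeFin.symm (0, π)

theorem pih_zero {n : ℕ} (π : Perm (Fin n)) : pih π 0 = 0 := by simp [pih]

theorem cpi_eq {n : ℕ} (π : Perm (Fin n)) :
    cpi π = (pih π * (sN n)⁻¹ * (pih π)⁻¹) * sN n := by
  have h : (Equiv.subRight (1 : ZMod (n+1))) = (sN n)⁻¹ := by
    have h1 : ∀ a : ZMod (n+1), a - 1 = a + -1 := fun a => sub_eq_add_neg a 1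
    exact Equiv.ext h1
  unfold cpi
  rw [h]
  rfl

theorem sum_A {R : Type*} [CommRing R] (x : R) (n : ℕ)
    [DecidablePred fun σ : Perm (Fin (n+1)) => ∀ y, SameCycle σ 0 y] :
    ∑ π : Perm (Fin n), x ^ A n π =
     ∑ σ ∈ (Finset.univ : Finset (Perm (Fin (n+1)))).filter (fun σ => ∀ y, SameCycle σ 0 y),
        x ^ cyc (σ * sN n) := by
  have hall : ∀ y, SameCycle (sN n) 0 y := fun y => ⟨(y.val : ℕ), by rw [zpow_natCast, sN_pow]⟩
  refine Finset.sum_bij (fun π _ => pih π * (sN n)⁻¹ * (pih π)⁻¹) ?_ ?_ ?_ ?_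
  · intro π _
    rw [Finset.mem_filter]
    refine ⟨Finset.mem_univ _, fun y => ?_⟩
    rw [sameCycle_conj, sameCycle_inv]
    exact (hall _).symm.trans (hall _)
  · intro π _ π' _ h
    have hc : ((pih π')⁻¹ * pih π) * sN n = sN n * ((pih π')⁻¹ * pih π) := by
      have h' := congrArg (fun t => (pih π')⁻¹ * t⁻¹ * pih π) h
      simp only [mul_inv_rev, inv_inv] at h'
      calc _ = (pih π')⁻¹ * (pih π * (sN n * (pih π)⁻¹)) * pih π := by group
        _ = _ := h'
        _ = _ := by group
    have h1 : (pih π')⁻¹ * pih π = 1 := by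
      ext1 j
      have hp : Commute ((pih π')⁻¹ * pih π) ((sN n) ^ j.val) := Commute.pow_right hc _
      have h0 : ((pih π')⁻¹ * pih π) 0 = 0 := by
        rw [Perm.mul_apply, pih_zero, Perm.inv_eq_iff_eq, pih_zero]
      have h2 := congrArg (fun t : Perm (Fin (n+1)) => t 0) hp.eq
      simp only [Perm.mul_apply _ ((sN n) ^ j.val), sN_pow] at h2
      rw [h2, Perm.mul_apply, h0, sN_pow]; rfl
    have h3 : pih π = pih π' := (inv_mul_eq_one.1 h1).symm
    have h4 := Perm.decomposeFin.symm.injective h3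
    exact (Prod.ext_iff.1 h4).2
  · intro σ hσ
    rw [Finset.mem_filter] at hσ
    have hcyc : (σ⁻¹).IsCycleOn ((Finset.univ : Finset (Fin (n+1))) : Set (Fin (n+1))) := by
      rw [isCycleOn_inv]
      refine ⟨by simpa using σ.bijective, ?_⟩
      intro a _ b _
      exact (hσ.2 a).symm.trans (hσ.2 b)
    let f : Fin (n+1) → Fin (n+1) := fun j => ((σ⁻¹) ^ j.val) 0
    have hf : Function.Surjective f := by
      intro y
      obtain ⟨m, hm, hmy⟩ := hcyc.exists_pow_eq (Finset.mem_univ 0) (Finset.mem_univ y)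
      rw [Finset.card_univ, Fintype.card_fin] at hm
      exact ⟨⟨m, hm⟩, hmy⟩
    let ρ : Perm (Fin (n+1)) := Equiv.ofBijective f (Finite.surjective_iff_bijective.1 hf)
    have hρ : ∀ j, ρ (sN n j) = σ⁻¹ (ρ j) := by
      intro j
      change ((σ⁻¹) ^ (sN n j).val) 0 = σ⁻¹ (((σ⁻¹) ^ j.val) 0)
      rw [← Perm.mul_apply, ← pow_succ']
      by_cases hj : j.val < n
      · rw [sN_val n j hj]
      · have hjn : j.val = n := by have := j.isLt; omega
        have := hcyc.pow_card_apply (Finset.mem_univ 0)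
        rw [Finset.card_univ, Fintype.card_fin] at this
        rw [sN_last n j hjn, hjn, this]; rfl
    have hρ0 : ρ 0 = 0 := rfl
    have hρσ : ρ * (sN n)⁻¹ * ρ⁻¹ = σ := by
      have : ρ * sN n = σ⁻¹ * ρ := by ext1 j; exact hρ j
      have h2 : σ⁻¹ = ρ * sN n * ρ⁻¹ := by rw [this]; group
      rw [← inv_inv σ, h2]; group
    refine ⟨(Perm.decomposeFin ρ).2, Finset.mem_univ _, ?_⟩
    have hpih : pih (Perm.decomposeFin ρ).2 = ρ := by
      have h1 : (Perm.decomposeFin ρ).1 = 0 := by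
        obtain ⟨⟨a, b⟩, hab⟩ : ∃ ab, ab = Perm.decomposeFin ρ := ⟨_, rfl⟩
        have h2 : ρ = Perm.decomposeFin.symm (a, b) := by rw [hab, Equiv.symm_apply_apply]
        rw [← hab]
        have : ρ 0 = a := by rw [h2]; simp
        rw [← this, hρ0]
      unfold pih
      rw [← h1]; exact Equiv.symm_apply_apply _ _
    rw [hpih, hρσ]
  · intro π _
    rw [A_eq_cyc, cpi_eq]
    rfl

theorem Rz_succ {R : Type*} [CommRing R] (x : R) (N : ℕ) : Rz x (N + 1) = Rz x N * (x + N) := by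
  simp [Rz, Finset.prod_range_succ]
theorem Fz_succ {R : Type*} [CommRing R] (x : R) (N : ℕ) : Fz x (N + 1) = Fz x N * (x - N) := by
  simp [Fz, Finset.prod_range_succ]

theorem tele {R : Type*} [CommRing R] (x : R) (n m : ℕ) (hm : m ≤ n) :
    ((n:R) + 1) * (n + 2) * ∑ k ∈ Finset.range m, ((n - k : ℕ) : R) * (Fz x (k + 1) * Rz x (n - k)) =
     ((n:R) + 2) * (n + 1) * (x * Rz x (n + 1)) - x * Rz x (n + 2)
      - ((n + 2) * ((n - m : ℕ) + 1) * (Fz x (m + 1) * Rz x (n - m + 1))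
          - Fz x (m + 1) * Rz x (n - m + 2)) := by
  induction m with
  | zero =>
    have : Fz x 1 = x := by simp [Fz]
    simp [this]
  | succ m ih =>
    rw [Finset.sum_range_succ, mul_add, ih (by omega)]
    obtain ⟨j, rfl⟩ : ∃ j, n = m + 1 + j := ⟨n - (m + 1), by omega⟩
    have e1 : m + 1 + j - m = j + 1 := by omega
    have e2 : m + 1 + j - (m + 1) = j := by omega
    rw [e1, e2, Fz_succ x (m + 1), Rz_succ x (j + 1 + 1), Rz_succ x (j + 1)]
    push_cast
    ring

theorem closed {R : Type*} [CommRing R] (x : R) (n : ℕ) :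
    x * (((n:R) + 1) * (n + 2) * ∑ π : Perm (Fin n), x ^ A n π) =
      x * (Rz x (n + 2) - Fz x (n + 2)) := by
  classical
  have h1 := sum_trans x n (sN n) (sN_val n)
  rw [← sum_A x n] at h1
  have h2 := tele x n n le_rfl
  have hR1 : Rz x 1 = x := by simp [Rz]
  have hR2 : Rz x 2 = x * (x + 1) := by simp [Rz, Finset.prod_range_succ]
  rw [Nat.sub_self, zero_add, zero_add, hR1, hR2] at h2
  rw [Fz_succ x (n + 1)]
  push_cast at h2 ⊢
  linear_combination ((n:R) + 1) * (n + 2) * h1 - h2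

open Polynomial in
noncomputable def PP (n : ℕ) : ℚ[X] := ∑ π : Perm (Fin n), (X : ℚ[X]) ^ A n π

open Polynomial in
theorem PP_closed (n : ℕ) : ((n : ℚ[X]) + 1) * ((n : ℚ[X]) + 2) * PP n =
    Rz (X : ℚ[X]) (n + 2) - Fz (X : ℚ[X]) (n + 2) := by
  have h := closed (X : ℚ[X]) n
  have h' := mul_left_cancel₀ (X_ne_zero (R := ℚ)) h
  unfold PP
  exact h'

open Polynomial in
theorem PP_rec (m : ℕ) : ((m : ℚ[X]) + 4) * PP (m + 2) =
    (2 * (m : ℚ[X]) + 5) * ((X : ℚ[X]) * PP (m + 1))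
    - ((m : ℚ[X]) + 1) * ((X : ℚ[X]) ^ 2 * PP m)
    + ((m : ℚ[X]) + 2) ^ 2 * ((m : ℚ[X]) + 1) * PP m := by
  have h0 := PP_closed m
  have h1 := PP_closed (m + 1)
  have h2 := PP_closed (m + 2)
  have hne : ((m : ℚ[X]) + 1) * ((m : ℚ[X]) + 2) * ((m : ℚ[X]) + 3) ≠ 0 := by
    have : ((m : ℚ[X]) + 1) * ((m : ℚ[X]) + 2) * ((m : ℚ[X]) + 3) =
        (((m + 1) * (m + 2) * (m + 3) : ℕ) : ℚ[X]) := by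
      push_cast; ring
    rw [this, Nat.cast_ne_zero]; positivity
  apply mul_left_cancel₀ hne
  rw [show m + 1 + 2 = (m + 2) + 1 from rfl, Rz_succ _ (m + 2), Fz_succ _ (m + 2)] at h1
  rw [Rz_succ _ (m + 2 + 1), Fz_succ _ (m + 2 + 1), Rz_succ _ (m + 2), Fz_succ _ (m + 2)] at h2
  push_cast at h0 h1 h2 ⊢
  linear_combination ((m : ℚ[X]) + 1) * ((m : ℚ[X]) + 2) * h2
    - (2 * (m : ℚ[X]) + 5) * ((m : ℚ[X]) + 1) * (X : ℚ[X]) * h1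
    + ((m : ℚ[X]) + 3) * ((m : ℚ[X]) + 1) * ((X : ℚ[X]) ^ 2 - ((m : ℚ[X]) + 2) ^ 2) * h0

theorem PP_coeff (n k : ℕ) : (PP n).coeff k = (H n k : ℚ) := by
  classical
  unfold PP H
  rw [Polynomial.finsetSum_coeff]
  simp only [Polynomial.coeff_X_pow]
  rw [Finset.sum_boole, Nat.card_eq_fintype_card, Fintype.card_subtype]
  congr 2
  ext π; simp [eq_comm]

theorem H_zero (n : ℕ) : H n 0 = 0 := by
  unfold H
  have : IsEmpty {π : Perm (Fin n) // A n π = 0} := by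
    refine ⟨fun ⟨π, h⟩ => ?_⟩
    rw [A_eq_cyc, cyc] at h
    have : Nonempty (Quotient (SameCycle.setoid (cpi π))) := ⟨Quotient.mk _ 0⟩
    have : Finite (ZMod (n+1)) := inferInstanceAs (Finite (Fin (n+1)))
    exact Nat.card_pos.ne' h
  simp

theorem a_rec (g m : ℕ) (hg : 1 ≤ g) :
    ((m : ℚ) + 4) * H (m + 2) (m + 2 + 1 - 2 * g) = (2 * m + 5) * H (m + 1) (m + 1 + 1 - 2 * g)
    - (m + 1) * H m (m + 1 - 2 * g) + (m + 2) ^ 2 * (m + 1) * H m (m + 1 - 2 * (g - 1)) := by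
  have e : m + 1 - 2 * (g - 1) = m + 2 + 1 - 2 * g := by omega
  rw [e]
  obtain hk | ⟨k, hk⟩ : m + 2 + 1 - 2 * g = 0 ∨ ∃ k, m + 2 + 1 - 2 * g = k + 1 := by
    rcases Nat.eq_zero_or_pos (m + 2 + 1 - 2 * g) with h | h
    · exact Or.inl h
    · exact Or.inr ⟨m + 2 + 1 - 2 * g - 1, by omega⟩
  · have h1 : m + 1 + 1 - 2 * g = 0 := by omega
    have h2 : m + 1 - 2 * g = 0 := by omega
    rw [hk, h1, h2]; simp [H_zero]
  · have h1 : m + 1 + 1 - 2 * g = k := by omega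
    have h2 : m + 1 - 2 * g = k - 1 := by omega
    rw [hk, h1, h2]
    have hc := congrArg (fun p => Polynomial.coeff p (k + 1)) (PP_rec m)
    have hr : (Polynomial.C ((m : ℚ) + 4)) * PP (m + 2) =
        Polynomial.C (2 * (m:ℚ) + 5) * (Polynomial.X * PP (m + 1))
        - Polynomial.C ((m:ℚ) + 1) * (Polynomial.X * (Polynomial.X * PP m))
        + Polynomial.C (((m:ℚ) + 2) ^ 2 * (m + 1)) * PP m := by
      have := PP_rec m
      simp only [map_add, map_mul, map_pow, map_natCast, map_ofNat, map_one]
      linear_combination this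
    have hc := congrArg (fun p => Polynomial.coeff p (k + 1)) hr
    simp only [Polynomial.coeff_add, Polynomial.coeff_sub, Polynomial.coeff_C_mul,
      Polynomial.coeff_X_mul, PP_coeff] at hc
    rcases k with _ | k
    · simpa [H_zero] using hc
    · simpa [Polynomial.coeff_X_mul, PP_coeff] using hc

theorem coeff_Ht (g n : ℕ) : PowerSeries.coeff (n + 2) (Ht g) = (H n (n + 1 - 2 * g) : ℚ) := by
  unfold Ht HgQ
  rw [PowerSeries.coeff_X_pow_mul, PowerSeries.coeff_mk]

theorem coeff_Ht_zero (g : ℕ) : PowerSeries.coeff 0 (Ht g) = 0 := by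
  unfold Ht; rw [PowerSeries.coeff_X_pow_mul']; simp

theorem coeff_Ht_one (g : ℕ) : PowerSeries.coeff 1 (Ht g) = 0 := by
  unfold Ht; rw [PowerSeries.coeff_X_pow_mul']; simp

/-- The differential equation
`(1-X)² H̃_g'(X) + (1-X) H̃_g(X) = X⁴ H̃_{g-1}'''(X) + 2 X³ H̃_{g-1}''(X)`
relating consecutive genus generating functions. -/
theorem hultman_genus_series_ODE (g : ℕ) (hg : 1 ≤ g) :
    (1 - PowerSeries.X) ^ 2 * PowerSeries.derivative ℚ (Ht g) +
        (1 - PowerSeries.X) * Ht g =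
      PowerSeries.X ^ 4 *
          PowerSeries.derivative ℚ
            (PowerSeries.derivative ℚ (PowerSeries.derivative ℚ (Ht (g - 1)))) +
        2 * PowerSeries.X ^ 3 *
          PowerSeries.derivative ℚ (PowerSeries.derivative ℚ (Ht (g - 1))) := by
  set D := PowerSeries.derivative ℚ (Ht g) with hD
  set D2 := PowerSeries.derivative ℚ (PowerSeries.derivative ℚ (Ht (g - 1))) with hD2
  have hl : (1 - PowerSeries.X) ^ 2 * D + (1 - PowerSeries.X) * Ht g =
      D - PowerSeries.C (2:ℚ) * (PowerSeries.X ^ 1 * D) + PowerSeries.X ^ 2 * D + Ht g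
        - PowerSeries.X ^ 1 * Ht g := by
    simp only [map_ofNat]; ring
  have hr : PowerSeries.X ^ 4 * PowerSeries.derivative ℚ D2 + 2 * PowerSeries.X ^ 3 * D2 =
      PowerSeries.X ^ 4 * PowerSeries.derivative ℚ D2
        + PowerSeries.C (2:ℚ) * (PowerSeries.X ^ 3 * D2) := by
    simp only [map_ofNat]; ring
  rw [hl, hr]
  have cD : ∀ n, PowerSeries.coeff n D = PowerSeries.coeff (n + 1) (Ht g) * (n + 1) := by
    intro n; rw [hD, PowerSeries.coeff_derivative]
  have cD2 : ∀ n, PowerSeries.coeff n D2 =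
      PowerSeries.coeff (n + 2) (Ht (g - 1)) * (n + 2) * (n + 1) := by
    intro n; rw [hD2, PowerSeries.coeff_derivative, PowerSeries.coeff_derivative]; push_cast; ring
  ext j
  simp only [map_add, map_sub, PowerSeries.coeff_C_mul, PowerSeries.coeff_X_pow_mul',
    PowerSeries.coeff_derivative]
  have z0 : H 0 (0 + 1 - 2 * g) = 0 := by
    have : 0 + 1 - 2 * g = 0 := by omega
    rw [this, H_zero]
  have z1 : H 1 (1 + 1 - 2 * g) = 0 := by
    have : 1 + 1 - 2 * g = 0 := by omega
    rw [this, H_zero]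
  have c2 : PowerSeries.coeff 2 (Ht g) = 0 := by rw [coeff_Ht g 0, z0]; simp
  have c3 : PowerSeries.coeff 3 (Ht g) = 0 := by rw [coeff_Ht g 1, z1]; simp
  rcases j with _ | _ | _ | m
  · simp [cD, coeff_Ht_zero, coeff_Ht_one]
  · simp [cD, coeff_Ht_zero, coeff_Ht_one, c2]
  · simp [cD, coeff_Ht_zero, coeff_Ht_one, c2, c3]
  · have h := a_rec g m hg
    rw [← coeff_Ht g (m + 2), ← coeff_Ht g (m + 1), ← coeff_Ht g m, ← coeff_Ht (g - 1) m] at h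
    have i1 : m + 1 + 1 + 1 - 1 = m + 2 := by omega
    have i2 : m + 1 + 1 + 1 - 2 = m + 1 := by omega
    have i3 : m + 1 + 1 + 1 - 3 = m := by omega
    have q1 : 1 ≤ m + 1 + 1 + 1 := by omega
    have q2 : 2 ≤ m + 1 + 1 + 1 := by omega
    have q3 : 3 ≤ m + 1 + 1 + 1 := by omega
    rw [i1, i2, i3, if_pos q1, if_pos q2, if_pos q3, if_pos q1]
    rcases m with _ | m
    · simp only [cD, cD2] at h ⊢
      norm_num at h ⊢
      linarith
    · have i4 : m + 1 + 1 + 1 + 1 - 4 = m := by omega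
      have q4 : 4 ≤ m + 1 + 1 + 1 + 1 := by omega
      rw [i4, if_pos q4]
      simp only [cD, cD2] at h ⊢
      push_cast at h ⊢
      linear_combination h
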